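/- arXiv:2604.02885 — 3 statements merged into one kernel-verified Lean document; each statement's English description precedes it below -/
import Mathlib

section
/- Let q be a prime power, ε ∈ {+1, −1}, and let i be a positive integer with φ(i) > 4, where φ is Euler's totient function. Then k_i(εq) > q^4. -/
/-- `e(r,a)`: for odd prime `r` coprime to `a`, the multiplicative order of `a` modulo `r`;
for `r = 2` and odd `a`, it is `1` if `a ≡ 1 (mod 4)` and `2` if `a ≡ 3 (mod 4)`. -/
noncomputable def eOrd (r : ℕ) (a : ℤ) : ℕ :=
  if r = 2 then (if a % 4 = 1 then 1 else 2) else orderOf (a : ZMod r)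

/-- `k_i(a)`: the product, over all primitive prime divisors `r` of `a^i - 1`
(i.e. primes `r` with `e(r,a) = i`), of the `r`-part of `a^i - 1`. -/
noncomputable def kPart (i : ℕ) (a : ℤ) : ℕ :=
  ∏ r ∈ (a ^ i - 1).natAbs.primeFactors.filter (fun r => eOrd r a = i),
    r ^ (a ^ i - 1).natAbs.factorization r

open Polynomial

theorem orderOf_eq_of_dvd_eval_cyclotomic {p k m : ℕ} [Fact p.Prime] (hm : ¬ p ∣ m) {a : ℤ}
    (h : (p : ℤ) ∣ (cyclotomic (p ^ k * m) ℤ).eval a) : orderOf (a : ZMod p) = m := by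
  have : NeZero (m : ZMod p) := ⟨by rwa [Ne, ZMod.natCast_eq_zero_iff]⟩
  have hroot : (cyclotomic (p ^ k * m) (ZMod p)).IsRoot (a : ZMod p) := by
    rw [← map_cyclotomic_int, IsRoot, eval_intCast_map, eq_intCast,
      ZMod.intCast_zmod_eq_zero_iff_dvd]
    exact h
  exact (isRoot_cyclotomic_prime_pow_mul_iff_of_charP.1 hroot).eq_orderOf.symm

theorem dvd_sub_one_of_dvd_eval_cyclotomic {p k m : ℕ} [Fact p.Prime] (hm : ¬ p ∣ m) {a : ℤ}
    (h : (p : ℤ) ∣ (cyclotomic (p ^ k * m) ℤ).eval a) : m ∣ p - 1 := by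
  have ho := orderOf_eq_of_dvd_eval_cyclotomic hm h
  have ha : (a : ZMod p) ≠ 0 := by
    intro h0
    rw [h0, orderOf_zero] at ho
    exact hm (ho ▸ dvd_zero p)
  exact ho ▸ ZMod.orderOf_dvd_card_sub_one ha

theorem le_of_dvd_eval_cyclotomic {p r i : ℕ} (hp : p.Prime) (hr : r.Prime) (hi : i ≠ 0)
    (hri : r ∣ i) {a : ℤ} (h : (p : ℤ) ∣ (cyclotomic i ℤ).eval a) : r ≤ p := by
  have := Fact.mk hp
  obtain ⟨k, m, hm, rfl⟩ := Nat.exists_eq_pow_mul_and_not_dvd hi p hp.ne_one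
  have hdvd := dvd_sub_one_of_dvd_eval_cyclotomic hm h
  rcases hr.dvd_mul.1 hri with h1 | h1
  · exact Nat.le_of_dvd hp.pos (hr.dvd_of_dvd_pow h1)
  · have := Nat.le_of_dvd (Nat.sub_pos_of_lt hp.one_lt) (h1.trans hdvd)
    omega

theorem cyclotomic_mul_dvd_geom_sum {p d : ℕ} (hp : 1 < p) (hd : 0 < d) (a : ℤ) :
    (cyclotomic (p * d) ℤ).eval a ∣ ∑ j ∈ Finset.range p, (a ^ d) ^ j := by
  have h := X_pow_sub_one_mul_cyclotomic_dvd_X_pow_sub_one_of_dvd ℤ (d := d) (n := p * d)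
    (Nat.mem_properDivisors.2 ⟨dvd_mul_left _ _, by nlinarith⟩)
  have h2 : (X : ℤ[X]) ^ (p * d) - 1 =
      (X ^ d - 1) * ∑ j ∈ Finset.range p, ((X : ℤ[X]) ^ d) ^ j := by
    rw [mul_geom_sum, ← pow_mul, mul_comm]
  rw [h2] at h
  have h0 : (X : ℤ[X]) ^ d - 1 ≠ 0 := by
    simpa using X_pow_sub_C_ne_zero hd (1 : ℤ)
  have h3 := eval_dvd (x := a) ((mul_dvd_mul_iff_left h0).1 h)
  simpa [eval_finsetSum] using h3

theorem not_sq_dvd_eval_cyclotomic {p i : ℕ} (hp : p.Prime) (hi : 2 < i) (hpi : p ∣ i) (a : ℤ) :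
    ¬ (p : ℤ) ^ 2 ∣ (cyclotomic i ℤ).eval a := by
  intro h
  have := Fact.mk hp
  obtain ⟨k, m, hm, rfl⟩ := Nat.exists_eq_pow_mul_and_not_dvd (by omega : i ≠ 0) p hp.ne_one
  have hm0 : 0 < m := Nat.pos_of_ne_zero (by rintro rfl; simp at hm)
  obtain _ | k := k
  · simp [hm] at hpi
  have hp1 : (p : ℤ) ∣ (cyclotomic (p ^ (k + 1) * m) ℤ).eval a :=
    (dvd_pow_self _ two_ne_zero).trans h
  have ho := orderOf_eq_of_dvd_eval_cyclotomic hm hp1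
  have hd := dvd_sub_one_of_dvd_eval_cyclotomic hm hp1
  have hb : (p : ℤ) ∣ a ^ (p ^ k * m) - 1 := by
    rw [← ZMod.intCast_zmod_eq_zero_iff_dvd]
    push_cast
    rw [mul_comm, pow_mul, ← ho, pow_orderOf_eq_one, one_pow, sub_self]
  have hsum : (p : ℤ) ^ 2 ∣ ∑ j ∈ Finset.range p, (a ^ (p ^ k * m)) ^ j := by
    refine h.trans ?_
    have := cyclotomic_mul_dvd_geom_sum hp.one_lt (d := p ^ k * m) (by have := hp.pos; positivity) a
    rwa [← mul_assoc, ← pow_succ'] at this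
  rcases hp.eq_two_or_odd' with rfl | hodd
  · obtain rfl : m = 1 := by simpa using hd
    obtain _ | k := k
    · simp at hi
    have hx : a ^ (2 ^ (k + 1) * 1) = (a ^ 2 ^ k) ^ 2 := by rw [← pow_mul]; ring_nf
    rw [hx] at hsum
    simp only [Finset.sum_range_succ, Finset.sum_range_zero] at hsum
    generalize a ^ 2 ^ k = x at hsum
    have h4 : (1 + x ^ 2) % 4 = 0 := by
      apply Int.emod_eq_zero_of_dvd
      simpa using hsum
    have : x % 4 = 0 ∨ x % 4 = 1 ∨ x % 4 = 2 ∨ x % 4 = 3 := by omega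
    rcases this with h | h | h | h <;> simp [pow_two, Int.add_emod, Int.mul_emod, h] at h4
  · obtain ⟨c, hc⟩ := hb
    have h1 := odd_sq_dvd_geom_sum₂_sub (R := ℤ) (a := 1) (b := c) (p := p) hodd
    have hc' : a ^ (p ^ k * m) = 1 + p * c := by linarith
    rw [hc'] at hsum
    simp only [one_pow, mul_one] at h1
    have h2 := (dvd_sub_right hsum).1 h1
    have h3 : p ^ 2 ∣ p := by exact_mod_cast h2
    have := Nat.le_of_dvd hp.pos h3
    nlinarith [hp.one_lt]

theorem eval_cyclotomic_dvd_pow_sub_one {i : ℕ} (a : ℤ) :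
    (cyclotomic i ℤ).eval a ∣ a ^ i - 1 := by
  simpa using eval_dvd (x := a) (cyclotomic.dvd_X_pow_sub_one i ℤ)

theorem pow_factorization_dvd_kPart {p i : ℕ} {a : ℤ} (hp : p.Prime) (hi : 2 < i)
    (ha : a ^ i - 1 ≠ 0) (hpi : ¬ p ∣ i) (h : (p : ℤ) ∣ (cyclotomic i ℤ).eval a) :
    p ^ (a ^ i - 1).natAbs.factorization p ∣ kPart i a := by
  have := Fact.mk hp
  have h' : (p : ℤ) ∣ (cyclotomic (p ^ 0 * i) ℤ).eval a := by simpa using h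
  have hp2 : p ≠ 2 := by
    rintro rfl
    have := Nat.le_of_dvd one_pos (dvd_sub_one_of_dvd_eval_cyclotomic hpi h')
    omega
  refine Finset.dvd_prod_of_mem (fun r => r ^ (a ^ i - 1).natAbs.factorization r) ?_
  rw [Finset.mem_filter, Nat.mem_primeFactors]
  refine ⟨⟨hp, ?_, by simpa using ha⟩, ?_⟩
  · exact Int.natCast_dvd.1 (h.trans (eval_cyclotomic_dvd_pow_sub_one a))
  · rw [eOrd, if_neg hp2, orderOf_eq_of_dvd_eval_cyclotomic hpi h']

/-- Up to at most one prime divisor of `i`, the value `Φ_i(a)` divides `k_i(a)`. -/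
theorem exists_natAbs_eval_cyclotomic_dvd_kPart_mul {i : ℕ} {a : ℤ} (hi : 2 < i)
    (ha : a ^ i - 1 ≠ 0) :
    ∃ s : ℕ, (s = 1 ∨ s.Prime ∧ s ∣ i ∧ (s : ℤ) ∣ (cyclotomic i ℤ).eval a) ∧
      ((cyclotomic i ℤ).eval a).natAbs ∣ kPart i a * s := by
  have key : ∀ p k : ℕ, p.Prime → p ^ k ∣ ((cyclotomic i ℤ).eval a).natAbs → ¬ p ∣ i →
      p ^ k ∣ kPart i a := by
    intro p k hp hk hpi
    obtain rfl | hk0 := eq_or_ne k 0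
    · simp
    have h1 : (p : ℤ) ∣ (cyclotomic i ℤ).eval a :=
      Int.natCast_dvd.2 ((dvd_pow_self p hk0).trans hk)
    refine dvd_trans (pow_dvd_pow p ?_) (pow_factorization_dvd_kPart hp hi ha hpi h1)
    refine (hp.pow_dvd_iff_le_factorization (by simpa using ha)).1 (hk.trans ?_)
    exact Int.natAbs_dvd_natAbs.2 (eval_cyclotomic_dvd_pow_sub_one a)
  by_cases hs : ∃ s : ℕ, s.Prime ∧ s ∣ i ∧ (s : ℤ) ∣ (cyclotomic i ℤ).eval a
  · obtain ⟨s, hsp, hsi, hsd⟩ := hs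
    refine ⟨s, Or.inr ⟨hsp, hsi, hsd⟩, ?_⟩
    rw [Nat.dvd_iff_prime_pow_dvd_dvd]
    intro p k hp hk
    by_cases hpi : p ∣ i
    · obtain rfl | hk0 := eq_or_ne k 0
      · simp
      have h1 : (p : ℤ) ∣ (cyclotomic i ℤ).eval a :=
        Int.natCast_dvd.2 ((dvd_pow_self p hk0).trans hk)
      obtain rfl : p = s := le_antisymm (le_of_dvd_eval_cyclotomic hsp hp (by omega) hpi hsd)
        (le_of_dvd_eval_cyclotomic hp hsp (by omega) hsi h1)
      have hk1 : k = 1 := by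
        by_contra hne
        refine not_sq_dvd_eval_cyclotomic hp hi hpi a ?_
        have := Int.natCast_dvd.2 ((pow_dvd_pow p (by omega : 2 ≤ k)).trans hk)
        exact_mod_cast this
      simp [hk1]
    · exact (key p k hp hk hpi).mul_right s
  · refine ⟨1, Or.inl rfl, ?_⟩
    rw [Nat.dvd_iff_prime_pow_dvd_dvd, mul_one]
    intro p k hp hk
    obtain rfl | hk0 := eq_or_ne k 0
    · simp
    refine key p k hp hk fun hpi => hs ⟨p, hp, hpi, ?_⟩
    exact Int.natCast_dvd.2 ((dvd_pow_self p hk0).trans hk)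

theorem quarter_lt_prod_one_sub_two_inv_pow (n : ℕ) :
    (1 / 4 : ℝ) < ∏ d ∈ Finset.Icc 1 n, (1 - (1 / 2 : ℝ) ^ d) := by
  obtain _ | n := n
  · norm_num
  suffices h : (1 / 4 : ℝ) + (1 / 2) ^ (n + 2) ≤
      ∏ d ∈ Finset.Icc 1 (n + 1), (1 - (1 / 2 : ℝ) ^ d) by
    have : (0 : ℝ) < (1 / 2) ^ (n + 2) := by positivity
    linarith
  induction n with
  | zero => norm_num
  | succ n ih =>
    rw [Finset.prod_Icc_succ_top (by omega)]
    have hle : (1 / 2 : ℝ) ^ n ≤ 1 := pow_le_one₀ (by norm_num) (by norm_num)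
    have hpos : (0 : ℝ) < (1 / 2) ^ n := by positivity
    have hf : (0 : ℝ) ≤ 1 - (1 / 2 : ℝ) ^ (n + 1 + 1) := by rw [pow_succ, pow_succ]; linarith
    refine le_trans ?_ (mul_le_mul_of_nonneg_right ih hf)
    simp only [pow_succ]
    nlinarith

theorem quarter_lt_prod_of_le {n : ℕ} {s : Finset ℕ} (hs : s ⊆ Finset.Icc 1 n) {f : ℕ → ℝ}
    (hf : ∀ d ∈ s, 1 - (1 / 2 : ℝ) ^ d ≤ f d) : (1 / 4 : ℝ) < ∏ d ∈ s, f d := by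
  have h0 : ∀ d : ℕ, (0 : ℝ) ≤ 1 - (1 / 2 : ℝ) ^ d := fun d =>
    sub_nonneg.2 (pow_le_one₀ (by norm_num) (by norm_num))
  have h1 : ∏ d ∈ s, (1 - (1 / 2 : ℝ) ^ d) ≤ ∏ d ∈ s, f d :=
    Finset.prod_le_prod (fun d _ => h0 d) hf
  have h2 : ∏ d ∈ Finset.Icc 1 n \ s, (1 - (1 / 2 : ℝ) ^ d) ≤ 1 :=
    Finset.prod_le_one (fun d _ => h0 d) fun d _ => by
      have : (0 : ℝ) < (1 / 2) ^ d := by positivity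
      linarith
  have h3 : 0 ≤ ∏ d ∈ s, (1 - (1 / 2 : ℝ) ^ d) := Finset.prod_nonneg fun d _ => h0 d
  have h4 := quarter_lt_prod_one_sub_two_inv_pow n
  rw [← Finset.prod_sdiff hs] at h4
  nlinarith

theorem one_sub_le_zpow_moebius {a : ℝ} (ha : 2 ≤ |a|) {d : ℕ} (hd : 0 < d) (k : ℕ) :
    1 - (1 / 2 : ℝ) ^ d ≤ (|a ^ d - 1| / |a| ^ d) ^ (ArithmeticFunction.moebius k) := by
  have hpow : (2 : ℝ) ^ d ≤ |a| ^ d := pow_le_pow_left₀ (by norm_num) ha d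
  have h2 : (2 : ℝ) ≤ 2 ^ d := le_self_pow₀ (by norm_num) hd.ne'
  have hlo : |a| ^ d - 1 ≤ |a ^ d - 1| := by
    simpa [abs_pow] using abs_sub_abs_le_abs_sub (a ^ d) 1
  have hhi : |a ^ d - 1| ≤ |a| ^ d + 1 := by
    simpa [abs_pow] using abs_sub (a ^ d) 1
  have hhalf : (1 / 2 : ℝ) ^ d = 1 / 2 ^ d := by rw [one_div_pow]
  rw [hhalf]
  set u := |a| ^ d
  set w := (2 : ℝ) ^ d
  set v := |a ^ d - 1|
  have hw : 0 < 1 / w := by positivity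
  have hu : 1 / u ≤ 1 / w := one_div_le_one_div_of_le (by linarith) hpow
  have hupos : 0 < u := by linarith
  rcases ArithmeticFunction.moebius_eq_or k with h | h | h
  · rw [h, zpow_zero]; linarith
  · rw [h, zpow_one]
    calc 1 - 1 / w ≤ 1 - 1 / u := by linarith
      _ = (u - 1) / u := by field_simp
      _ ≤ v / u := by gcongr
  · rw [h, zpow_neg_one, inv_div]
    have hvpos : 0 < v := by linarith
    rw [le_div_iff₀ hvpos]
    have h3 : 0 ≤ 1 - 1 / u := by
      rw [sub_nonneg, div_le_one hupos]; linarith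
    calc (1 - 1 / w) * v ≤ (1 - 1 / u) * v := by gcongr
      _ ≤ (1 - 1 / u) * (u + 1) := by gcongr
      _ = u - 1 / u := by field_simp; ring
      _ ≤ u := by have : 0 < 1 / u := by positivity
                  linarith

theorem abs_pow_totient_lt_four_mul_abs_eval_cyclotomic {a : ℝ} (ha : 2 ≤ |a|) {n : ℕ}
    (hn : 0 < n) : |a| ^ n.totient < 4 * |(cyclotomic n ℝ).eval a| := by
  have ha0 : 0 < |a| := by linarith
  have hne : ∀ m : ℕ, 0 < m → a ^ m - 1 ≠ 0 := by
    intro m hm h0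
    have h1 : |a| ^ m = 1 := by rw [← abs_pow, sub_eq_zero.1 h0, abs_one]
    have h2 := one_lt_pow₀ (by linarith : 1 < |a|) hm.ne'
    linarith
  have hprod : ∀ m > 0, ∏ d ∈ m.divisors, |(cyclotomic d ℝ).eval a| / |a| ^ d.totient =
      |a ^ m - 1| / |a| ^ m := by
    intro m hm
    rw [Finset.prod_div_distrib, Finset.prod_pow_eq_pow_sum, Nat.sum_totient,
      ← Finset.abs_prod, ← eval_prod, prod_cyclotomic_eq_X_pow_sub_one hm]
    simp
  have hcne : ∀ m : ℕ, 0 < m → (cyclotomic m ℝ).eval a ≠ 0 := by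
    intro m hm h0
    apply hne m hm
    have := eval_dvd (x := a) (cyclotomic.dvd_X_pow_sub_one m ℝ)
    rw [h0, zero_dvd_iff] at this
    simpa using this
  have h := (ArithmeticFunction.prod_eq_iff_prod_pow_moebius_eq_of_nonzero
    (f := fun d => |(cyclotomic d ℝ).eval a| / |a| ^ d.totient)
    (g := fun m => |a ^ m - 1| / |a| ^ m)
    (fun m hm => div_ne_zero (abs_ne_zero.2 (hcne m hm)) (by positivity))
    (fun m hm => div_ne_zero (abs_ne_zero.2 (hne m hm)) (by positivity))).1 hprod n hn
  rw [Nat.prod_divisorsAntidiagonal'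
    (f := fun x y => (|a ^ y - 1| / |a| ^ y) ^ (ArithmeticFunction.moebius x))] at h
  have h1 := quarter_lt_prod_of_le (n := n) (s := n.divisors)
    (f := fun d => (|a ^ d - 1| / |a| ^ d) ^ (ArithmeticFunction.moebius (n / d)))
    (fun d hd => Finset.mem_Icc.2 ⟨Nat.pos_of_mem_divisors hd, Nat.divisor_le hd⟩)
    (fun d hd => one_sub_le_zpow_moebius ha (Nat.pos_of_mem_divisors hd) _)
  rw [h, lt_div_iff₀ (by positivity)] at h1
  linarith

theorem natAbs_pow_totient_lt {a : ℤ} (ha : 2 ≤ a.natAbs) {n : ℕ} (hn : 0 < n) :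
    a.natAbs ^ n.totient < 4 * ((cyclotomic n ℤ).eval a).natAbs := by
  have hcast : |(a : ℝ)| = (a.natAbs : ℝ) := by rw [Nat.cast_natAbs, Int.cast_abs]
  have h := abs_pow_totient_lt_four_mul_abs_eval_cyclotomic (a := (a : ℝ))
    (by rw [hcast]; exact_mod_cast ha) hn
  have hc : (cyclotomic n ℝ).eval (a : ℝ) = (((cyclotomic n ℤ).eval a : ℤ) : ℝ) := by
    rw [← map_cyclotomic_int, eval_intCast_map, eq_intCast, Int.cast_id]
  rw [hc, hcast, ← Int.cast_abs, ← Nat.cast_natAbs] at h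
  exact_mod_cast h

theorem eval_cyclotomic_nine (a : ℤ) : (cyclotomic 9 ℤ).eval a = a ^ 6 + a ^ 3 + 1 := by
  have h := cyclotomic_prime_pow_eq_geom_sum (R := ℤ) (n := 1) Nat.prime_three
  norm_num [Finset.sum_range_succ] at h
  rw [h]
  simp
  ring

theorem eval_cyclotomic_mul_prime {p n : ℕ} (hp : p.Prime) (hn : ¬ p ∣ n) (a : ℤ) :
    (cyclotomic n ℤ).eval (a ^ p) = (cyclotomic (n * p) ℤ).eval a * (cyclotomic n ℤ).eval a := by
  rw [← eval_mul, ← cyclotomic_expand_eq_cyclotomic_mul hp hn, expand_eval]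

theorem eval_cyclotomic_mul_prime_of_dvd {p n : ℕ} (hp : p.Prime) (hn : p ∣ n) (a : ℤ) :
    (cyclotomic n ℤ).eval (a ^ p) = (cyclotomic (n * p) ℤ).eval a := by
  rw [← cyclotomic_expand_eq_cyclotomic hp hn, expand_eval]

theorem lt_natAbs_eval_cyclotomic_nine_or_eighteen {i : ℕ} (hi : i = 9 ∨ i = 18) {a : ℤ}
    (ha : a.natAbs = 2) : 48 < ((cyclotomic i ℤ).eval a).natAbs := by
  have h18 := eval_cyclotomic_mul_prime Nat.prime_two (n := 9) (by norm_num) a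
  simp only [eval_cyclotomic_nine, Nat.reduceMul] at h18
  rcases hi with rfl | rfl
  · rw [eval_cyclotomic_nine]
    rcases Int.natAbs_eq a with h | h <;> rw [ha] at h <;> subst h <;> norm_num
  · rcases Int.natAbs_eq a with h | h <;> rw [ha, Nat.cast_ofNat] at h <;> subst h <;>
      norm_num at h18 <;> omega

theorem lt_natAbs_eval_cyclotomic_twenty {a : ℤ} (ha : a.natAbs = 2) :
    80 < ((cyclotomic 20 ℤ).eval a).natAbs := by
  have : Fact (Nat.Prime 5) := ⟨by norm_num⟩
  have h5 : ∀ b : ℤ, (cyclotomic 5 ℤ).eval b = b ^ 4 + b ^ 3 + b ^ 2 + b + 1 := by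
    intro b
    rw [cyclotomic_prime]
    simp [Finset.sum_range_succ]
    ring
  have h10 := eval_cyclotomic_mul_prime Nat.prime_two (n := 5) (by norm_num) (a ^ 2)
  have h20 := eval_cyclotomic_mul_prime_of_dvd Nat.prime_two (n := 10) (by norm_num) a
  simp only [h5, Nat.reduceMul] at h10 h20
  have ha2 : a ^ 2 = 4 := by rw [← Int.natAbs_sq, ha]; norm_num
  rw [ha2] at h10 h20
  norm_num at h10
  omega

/-- The value `|Φ_i(a)|` exceeds `|a| ^ 4` times any prime divisor it shares with `i`. -/
theorem natAbs_pow_four_mul_lt {a : ℤ} (ha : 2 ≤ a.natAbs) {i s : ℕ} (hi : 2 < i)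
    (hphi : 4 < i.totient) (hs : s.Prime) (hsi : s ∣ i)
    (hsd : (s : ℤ) ∣ (cyclotomic i ℤ).eval a) :
    a.natAbs ^ 4 * s < ((cyclotomic i ℤ).eval a).natAbs := by
  have hlow := natAbs_pow_totient_lt ha (by omega : 0 < i)
  have heven := Nat.totient_even hi
  have := Fact.mk hs
  obtain ⟨k, m, hm, hik⟩ := Nat.exists_eq_pow_mul_and_not_dvd (by omega : i ≠ 0) s hs.ne_one
  obtain _ | k := k
  · simp [hik, hm] at hsi
  have hm0 : 0 < m := Nat.pos_of_ne_zero (by rintro rfl; simp at hm)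
  have hsd' := hsd
  rw [hik] at hsd'
  have hord := orderOf_eq_of_dvd_eval_cyclotomic hm hsd'
  have hms := dvd_sub_one_of_dvd_eval_cyclotomic hm hsd'
  have htot : i.totient = s ^ k * (s - 1) * m.totient := by
    rw [hik, Nat.totient_mul (Nat.Coprime.pow_left _ ((Nat.Prime.coprime_iff_not_dvd hs).2 hm)),
      Nat.totient_prime_pow_succ hs]
  have hdvd : s - 1 ∣ i.totient := ⟨s ^ k * m.totient, by rw [htot]; ring⟩
  have hsle : s - 1 ≤ i.totient := Nat.le_of_dvd (by omega) hdvd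
  -- It suffices to compare powers of `|a|`.
  have hmain : 4 * s ≤ a.natAbs ^ (i.totient - 4) →
      a.natAbs ^ 4 * s < ((cyclotomic i ℤ).eval a).natAbs := by
    intro h
    have h1 : a.natAbs ^ i.totient = a.natAbs ^ 4 * a.natAbs ^ (i.totient - 4) := by
      rw [← pow_add]; congr 1; omega
    have h2 := Nat.mul_le_mul_left (a.natAbs ^ 4) h
    rw [← h1] at h2
    linarith
  rcases le_or_gt 10 i.totient with hbig | hsmall
  · apply hmain
    obtain ⟨t, ht⟩ := Nat.exists_eq_add_of_le hbig
    have h2 : 4 * (t + 11) ≤ 2 ^ (t + 6) := by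
      clear * -
      induction t with
      | zero => norm_num
      | succ t ih => rw [show t + 1 + 6 = (t + 6) + 1 by ring, pow_succ]; omega
    calc 4 * s ≤ 4 * (t + 11) := by omega
      _ ≤ 2 ^ (t + 6) := h2
      _ ≤ a.natAbs ^ (t + 6) := Nat.pow_le_pow_left ha _
      _ = a.natAbs ^ (i.totient - 4) := by congr 1; omega
  have hphi' : i.totient = 6 ∨ i.totient = 8 := by
    obtain ⟨t, ht⟩ := heven
    omega
  have hs2 := hs.two_le
  have hs4 : s = 2 ∨ s = 3 ∨ s = 5 ∨ s = 7 := by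
    have : s ≤ 9 := by omega
    interval_cases s <;> first | omega | (exfalso; revert hs; norm_num)
  rcases hphi' with h6 | h8
  · rw [h6] at hmain htot hdvd
    rcases hs4 with rfl | rfl | rfl | rfl
    · obtain rfl : m = 1 := by simpa using hms
      have : 3 ∣ 2 ^ k := ⟨2, by simpa using htot.symm⟩
      have := Nat.prime_three.dvd_of_dvd_pow this
      omega
    · have hm2 : m ≤ 2 := Nat.le_of_dvd (by norm_num) hms
      have hm1 : m.totient = 1 := by interval_cases m <;> simp
      rw [hm1] at htot
      have hk : k = 1 := by
        obtain _ | _ | k := k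
        · omega
        · rfl
        · have : 0 < 3 ^ k := by positivity
          rw [pow_succ, pow_succ] at htot
          omega
      subst hk
      rcases (by omega : a.natAbs = 2 ∨ a.natAbs = 3 ∨ 4 ≤ a.natAbs) with h2 | h3 | h4
      · rw [h2]
        exact lt_natAbs_eval_cyclotomic_nine_or_eighteen
          (by rw [hik]; interval_cases m <;> simp) h2
      · have : (a : ZMod 3) = 0 := by
          rw [ZMod.intCast_zmod_eq_zero_iff_dvd]
          omega
        rw [this, orderOf_zero] at hord
        omega
      · apply hmain
        norm_num
        nlinarith
    · omega
    · have hm1 : m.totient = 1 := by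
        have : 7 ^ k * m.totient = 1 := by linarith
        exact Nat.eq_one_of_mul_eq_one_left this
      have hm2 : m ∣ 2 := by
        rcases Nat.totient_eq_one_iff.1 hm1 with rfl | rfl <;> norm_num
      have hsq : (7 : ℤ) ∣ a ^ 2 - 1 := by
        have h := orderOf_dvd_iff_pow_eq_one.1 (hord ▸ hm2)
        rw [← sub_eq_zero] at h
        have h' : ((a ^ 2 - 1 : ℤ) : ZMod 7) = 0 := by exact_mod_cast h
        exact (ZMod.intCast_zmod_eq_zero_iff_dvd _ 7).1 h'
      have h6 : 6 ≤ a.natAbs := by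
        by_contra hlt
        have hlo : -5 ≤ a := by omega
        have hhi : a ≤ 5 := by omega
        clear * - hsq ha hlo hhi
        interval_cases a <;> omega
      apply hmain
      norm_num
      nlinarith
  · rw [h8] at hmain htot hdvd
    rcases (by omega : a.natAbs = 2 ∨ 3 ≤ a.natAbs) with h2 | h3
    · rcases hs4 with rfl | rfl | rfl | rfl
      · exact hmain (by rw [h2]; norm_num)
      · exact hmain (by rw [h2]; norm_num)
      · have hm4 : m ≤ 4 := Nat.le_of_dvd (by norm_num) hms
        obtain _ | k := k
        · have : m = 4 := by
            interval_cases m <;> first | rfl | omega | norm_num at htot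
          rw [hik, this, h2]
          exact lt_natAbs_eval_cyclotomic_twenty h2
        · have h1 : 0 < 5 ^ k * m.totient :=
            Nat.mul_pos (by positivity) (Nat.totient_pos.2 hm0)
          rw [pow_succ] at htot
          have : 8 = 20 * (5 ^ k * m.totient) := by rw [htot]; ring
          omega
      · omega
    · apply hmain
      calc 4 * s ≤ 3 ^ 4 := by omega
        _ ≤ a.natAbs ^ 4 := Nat.pow_le_pow_left h3 _

theorem natAbs_pow_four_lt_kPart {a : ℤ} (ha : 2 ≤ a.natAbs) {i : ℕ} (hphi : 4 < i.totient) :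
    a.natAbs ^ 4 < kPart i a := by
  have hi : 2 < i := by
    have := Nat.totient_le i
    omega
  have hne : a ^ i - 1 ≠ 0 := by
    intro h
    have h1 : a.natAbs ^ i = 1 := by rw [← Int.natAbs_pow, sub_eq_zero.1 h]; rfl
    have h2 := Nat.one_lt_pow (by omega : i ≠ 0) (by omega : 1 < a.natAbs)
    omega
  have hlow := natAbs_pow_totient_lt ha (by omega : 0 < i)
  obtain ⟨s, hs, hdvd⟩ := exists_natAbs_eval_cyclotomic_dvd_kPart_mul hi hne
  have hkpos : 0 < kPart i a := Finset.prod_pos fun r hr =>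
    pow_pos (Nat.pos_of_mem_primeFactors (Finset.mem_filter.1 hr).1) _
  rcases hs with rfl | ⟨hs, hsi, hsd⟩
  · rw [mul_one] at hdvd
    have hle := Nat.le_of_dvd hkpos hdvd
    have h6 : 6 ≤ i.totient := by
      obtain ⟨t, ht⟩ := Nat.totient_even hi
      omega
    have h1 : a.natAbs ^ 4 * 2 ^ 2 ≤ a.natAbs ^ i.totient :=
      calc a.natAbs ^ 4 * 2 ^ 2 ≤ a.natAbs ^ 4 * a.natAbs ^ 2 := by gcongr
        _ = a.natAbs ^ 6 := by rw [← pow_add]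
        _ ≤ a.natAbs ^ i.totient := Nat.pow_le_pow_right (by omega) h6
    omega
  · have hle := Nat.le_of_dvd (Nat.mul_pos hkpos hs.pos) hdvd
    exact lt_of_mul_lt_mul_right
      ((natAbs_pow_four_mul_lt ha hi hphi hs hsi hsd).trans_le hle) (Nat.zero_le s)

/-- If `q` is a prime power, `ε = ±1` and `φ(i) > 4`, then `k_i(εq) > q^4`. -/
theorem kPart_gt_q_pow_four (q : ℕ) (hq : IsPrimePow q) (ε : ℤ) (hε : ε = 1 ∨ ε = -1)
    (i : ℕ) (hi : 0 < i) (hphi : 4 < Nat.totient i) :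
    q ^ 4 < kPart i (ε * q) := by
  have hq2 : 2 ≤ q := hq.two_le
  have habs : (ε * q).natAbs = q := by
    rcases hε with rfl | rfl <;> simp
  have h := natAbs_pow_four_lt_kPart (a := ε * q) (by omega) hphi
  rwa [habs] at h
end

section
/- Let q be a prime power and ε ∈ {+1, −1}. Then k_7(εq) > q^6/8 + 1. -/
lemma eOrd_eq_seven {r : ℕ} (hr : r.Prime) {a : ℤ} (h : (r : ℤ) ∣ a ^ 7 - 1)
    (h' : ¬ (r : ℤ) ∣ a - 1) : eOrd r a = 7 := by
  have : Fact (Nat.Prime 7) := ⟨by norm_num⟩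
  have h2 : r ≠ 2 := by
    rintro rfl
    have ha : ¬ Odd a := fun ho => h' (by obtain ⟨k, rfl⟩ := ho; exact ⟨k, by push_cast; ring⟩)
    have he : Even (a ^ 7) := (Int.not_odd_iff_even.mp ha).pow_of_ne_zero (by norm_num)
    obtain ⟨k, hk⟩ := he
    push_cast at h
    omega
  rw [eOrd, if_neg h2]
  apply orderOf_eq_prime
  · rw [← ZMod.intCast_zmod_eq_zero_iff_dvd _ r] at h
    push_cast at h
    exact sub_eq_zero.mp h
  · intro h1
    apply h'
    rw [← ZMod.intCast_zmod_eq_zero_iff_dvd _ r]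
    push_cast
    exact sub_eq_zero.mpr h1

/-- A divisor of `a ^ 7 - 1` that is coprime to `a - 1` divides `k_7(a)`. -/
lemma dvd_kPart_seven {a m : ℤ} (ha : a ^ 7 - 1 ≠ 0) (hm : m ∣ a ^ 7 - 1)
    (hc : IsCoprime m (a - 1)) : m ∣ (kPart 7 a : ℤ) := by
  have hm0 : m ≠ 0 := by rintro rfl; exact ha (zero_dvd_iff.mp hm)
  have hN : (a ^ 7 - 1).natAbs ≠ 0 := Int.natAbs_ne_zero.mpr ha
  have hdvd : m.natAbs ∣ (a ^ 7 - 1).natAbs := Int.natAbs_dvd_natAbs.mpr hm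
  rw [← Int.natAbs_dvd, Int.natCast_dvd_natCast,
    ← Nat.prod_factorization_pow_eq_self (Int.natAbs_ne_zero.mpr hm0), kPart]
  refine (Finset.prod_dvd_prod_of_dvd _ _ fun r _ => pow_dvd_pow r
    ((Nat.factorization_le_iff_dvd (Int.natAbs_ne_zero.mpr hm0) hN).mpr hdvd r)).trans
    (Finset.prod_dvd_prod_of_subset _ _ _ ?_)
  intro r hr
  have hr' : r ∈ m.natAbs.primeFactors := hr
  have hp := Nat.prime_of_mem_primeFactors hr'
  have hrm : (r : ℤ) ∣ m := Int.natCast_dvd.mpr (Nat.dvd_of_mem_primeFactors hr')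
  rw [Finset.mem_filter]
  refine ⟨Nat.primeFactors_mono hdvd hN hr', eOrd_eq_seven hp (hrm.trans hm) fun h => ?_⟩
  exact (Nat.prime_iff_prime_int.mp hp).not_isUnit (hc.isUnit_of_dvd' hrm h)

lemma kPart_pos (i : ℕ) (a : ℤ) : 0 < kPart i a :=
  Finset.prod_pos fun _ hr =>
    pow_pos (Nat.prime_of_mem_primeFactors (Finset.mem_filter.mp hr).1).pos _

/-- `Φ₇(a) ≤ k_7(a)` if `7 ∤ a - 1`, and `Φ₇(a) ≤ 7 k_7(a)` otherwise. -/
lemma cyclotomic_seven_le_kPart {a : ℤ} (ha : a ^ 7 - 1 ≠ 0) :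
    (¬ 7 ∣ a - 1 ∧ a ^ 6 + a ^ 5 + a ^ 4 + a ^ 3 + a ^ 2 + a + 1 ≤ (kPart 7 a : ℤ)) ∨
    (7 ∣ a - 1 ∧ a ^ 6 + a ^ 5 + a ^ 4 + a ^ 3 + a ^ 2 + a + 1 ≤ 7 * (kPart 7 a : ℤ)) := by
  have hpos : (0 : ℤ) < kPart 7 a := mod_cast kPart_pos 7 a
  by_cases h : (7 : ℤ) ∣ a - 1
  · refine Or.inr ⟨h, ?_⟩
    obtain ⟨t, ht⟩ := h
    obtain rfl : a = 7 * t + 1 := by linarith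
    set c : ℤ := 2401 * t ^ 5 + 2401 * t ^ 4 + 1029 * t ^ 3 + 245 * t ^ 2 + 35 * t + 3 with hcdef
    have hle := Int.le_of_dvd hpos (dvd_kPart_seven (m := 1 + 7 * t * c) ha
      ⟨7 * (7 * t), by rw [hcdef]; ring⟩ ⟨1, -c, by ring⟩)
    refine le_of_eq_of_le ?_ (mul_le_mul_of_nonneg_left hle (by norm_num : (0 : ℤ) ≤ 7))
    rw [hcdef]; ring
  · refine Or.inl ⟨h, Int.le_of_dvd hpos (dvd_kPart_seven ha ⟨a - 1, by ring⟩ ?_)⟩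
    have h7 : IsCoprime (7 : ℤ) (a - 1) :=
      (Prime.coprime_iff_not_dvd (by norm_num : Prime (7 : ℤ))).mpr h
    obtain ⟨u, v, huv⟩ := h7
    exact ⟨u, v - u * (a ^ 5 + 2 * a ^ 4 + 3 * a ^ 3 + 4 * a ^ 2 + 5 * a + 6),
      by linear_combination huv⟩

/-- For a prime power `q` and `ε = ±1`, `k_7(εq) > q^6/8 + 1`. -/
theorem kPart_seven_bound (q : ℕ) (hq : IsPrimePow q) (ε : ℤ) (hε : ε = 1 ∨ ε = -1) :
    (q : ℚ) ^ 6 / 8 + 1 < (kPart 7 (ε * q) : ℚ) := by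
  have hq2 : 2 ≤ q := hq.two_le
  have hq6 : q ≠ 6 := by
    rintro rfl
    have h := (isPrimePow_iff_unique_prime_dvd.mp hq).unique
      (y₁ := 2) (y₂ := 3) ⟨by norm_num, by norm_num⟩ ⟨by norm_num, by norm_num⟩
    omega
  suffices h : (q : ℤ) ^ 6 + 8 < 8 * (kPart 7 (ε * q) : ℤ) by
    have h' : (q : ℚ) ^ 6 + 8 < 8 * (kPart 7 (ε * q) : ℚ) := mod_cast h
    linarith
  rcases hε with rfl | rfl
  · obtain ⟨x, hx⟩ : ∃ x : ℕ, q = x + 2 := ⟨q - 2, by omega⟩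
    have hx' : (q : ℤ) = x + 2 := mod_cast hx
    have ha : (1 * (q : ℤ)) ^ 7 - 1 ≠ 0 := by
      have : 0 < (1 * (q : ℤ)) ^ 7 - 1 := by rw [hx']; ring_nf; positivity
      exact this.ne'
    have key : 7 * (q : ℤ) ^ 6 + 56 < 8 * (q ^ 6 + q ^ 5 + q ^ 4 + q ^ 3 + q ^ 2 + q + 1) := by
      rw [← sub_pos, hx']; ring_nf; positivity
    have hk : (0 : ℤ) < kPart 7 (1 * q) := mod_cast kPart_pos 7 _
    rcases cyclotomic_seven_le_kPart ha with ⟨-, h⟩ | ⟨-, h⟩ <;>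
      simp only [one_mul] at h hk ⊢ <;> linarith
  · have ha : (-1 * (q : ℤ)) ^ 7 - 1 ≠ 0 := by
      have h0 : (0 : ℤ) ≤ (q : ℤ) ^ 7 := by positivity
      have : (-1 * (q : ℤ)) ^ 7 - 1 = -(q : ℤ) ^ 7 - 1 := by ring
      omega
    rcases cyclotomic_seven_le_kPart ha with ⟨-, h⟩ | ⟨h7, h⟩
    · obtain ⟨x, hx⟩ : ∃ x : ℕ, q = x + 2 := ⟨q - 2, by omega⟩
      have hx' : (q : ℤ) = x + 2 := mod_cast hx
      have key : (q : ℤ) ^ 6 + 8 < 8 * (q ^ 6 - q ^ 5 + q ^ 4 - q ^ 3 + q ^ 2 - q + 1) := by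
        rw [← sub_pos, hx']; ring_nf; positivity
      linarith
    · obtain ⟨x, hx⟩ : ∃ x : ℕ, q = x + 13 := ⟨q - 13, by omega⟩
      have hx' : (q : ℤ) = x + 13 := mod_cast hx
      have key : 7 * (q : ℤ) ^ 6 + 56 < 8 * (q ^ 6 - q ^ 5 + q ^ 4 - q ^ 3 + q ^ 2 - q + 1) := by
        rw [← sub_pos, hx']; ring_nf; positivity
      linarith
end

section
/- Let a be an odd integer with |a| > 1. Then gcd(k_8(a) − 1, k_5(a) − 1) divides (a² + 1)(a + 1) if gcd(5, a − 1) = 1, and divides 4(a − 1) otherwise. -/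
theorem eOrd_eq_prime_pow_iff {p k r : ℕ} [Fact p.Prime] (hp : 3 ≤ p ^ (k + 1)) {a : ℤ}
    (hr : (r : ℤ) ∣ a ^ p ^ (k + 1) - 1) :
    eOrd r a = p ^ (k + 1) ↔ r ≠ 2 ∧ ¬ (r : ℤ) ∣ a ^ p ^ k - 1 := by
  by_cases h2 : r = 2
  · simp only [eOrd, h2, if_true, ne_eq, not_true_eq_false, false_and, iff_false]
    split_ifs <;> omega
  have key : ∀ n : ℕ, (a : ZMod r) ^ n = 1 ↔ (r : ℤ) ∣ a ^ n - 1 := fun n => by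
    rw [← ZMod.intCast_zmod_eq_zero_iff_dvd, Int.cast_sub, Int.cast_pow, Int.cast_one,
      sub_eq_zero]
  simp only [eOrd, h2, if_false, ne_eq, not_false_eq_true, true_and]
  constructor
  · intro h hd
    have := orderOf_dvd_of_pow_eq_one ((key _).2 hd)
    rw [h, Nat.pow_dvd_pow_iff_le_right (Fact.out : p.Prime).one_lt] at this
    omega
  · exact fun h => orderOf_eq_prime_pow (fun h' => h ((key _).1 h')) ((key _).2 hr)

/-- If the prime factors of `m` are exactly the primitive prime divisors of `a ^ i - 1` and `m` is
coprime to its cofactor, then `k_i(a) = m`. -/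
theorem kPart_eq_of_coprime {i m c : ℕ} {a : ℤ} (h0 : a ^ i - 1 ≠ 0)
    (h : (a ^ i - 1).natAbs = m * c) (hmc : m.Coprime c)
    (hm : ∀ r : ℕ, r.Prime → (r : ℤ) ∣ a ^ i - 1 → (eOrd r a = i ↔ r ∣ m)) :
    kPart i a = m := by
  have hne : m * c ≠ 0 := h ▸ Int.natAbs_ne_zero.2 h0
  have hm0 : m ≠ 0 := left_ne_zero_of_mul hne
  have hset : (a ^ i - 1).natAbs.primeFactors.filter (fun r => eOrd r a = i) =
      m.primeFactors := by
    ext r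
    simp only [Finset.mem_filter, Nat.mem_primeFactors]
    constructor
    · rintro ⟨⟨hr, hd, -⟩, he⟩
      exact ⟨hr, (hm r hr (Int.natCast_dvd.2 hd)).1 he, hm0⟩
    · rintro ⟨hr, hd, -⟩
      have hd' : r ∣ (a ^ i - 1).natAbs := h ▸ hd.mul_right c
      exact ⟨⟨hr, hd', h ▸ hne⟩, (hm r hr (Int.natCast_dvd.2 hd')).2 hd⟩
  rw [kPart, hset]
  conv_rhs => rw [← Nat.prod_factorization_pow_eq_self hm0]
  refine Finset.prod_congr rfl fun r hr => ?_
  rw [h, Nat.factorization_eq_of_coprime_left hmc (by simpa using hr)]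

/-- `k_i(a)` for a prime power `i = p ^ (k + 1)`, read off from a coprime factorization of
`a ^ i - 1`. -/
theorem kPart_prime_pow_eq {p k : ℕ} [Fact p.Prime] (hp : 3 ≤ p ^ (k + 1)) {a m c : ℤ}
    (h0 : a ^ p ^ (k + 1) - 1 ≠ 0) (h : a ^ p ^ (k + 1) - 1 = m * c) (hm0 : 0 ≤ m)
    (hodd : Odd m) (hmc : IsCoprime m c) (hbc : a ^ p ^ k - 1 ∣ c)
    (hcb : ∀ r : ℤ, Prime r → r ∣ c → r ∣ a ^ p ^ k - 1) :
    (kPart (p ^ (k + 1)) a : ℤ) = m := by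
  rw [kPart_eq_of_coprime h0 (by rw [h, Int.natAbs_mul]) (Int.isCoprime_iff_gcd_eq_one.1 hmc),
    Int.natAbs_of_nonneg hm0]
  intro r hr hd
  rw [eOrd_eq_prime_pow_iff hp hd, ← Int.natCast_dvd]
  have hr' : Prime (r : ℤ) := Nat.prime_iff_prime_int.1 hr
  constructor
  · rintro ⟨-, hb⟩
    exact (hr'.dvd_or_dvd (h ▸ hd)).resolve_right fun hc => hb (hcb _ hr' hc)
  · intro hrm
    refine ⟨?_, fun hb => hr'.not_isUnit (hmc.isUnit_of_dvd' hrm (hb.trans hbc))⟩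
    rintro rfl
    exact Int.not_even_iff_odd.2 hodd (even_iff_two_dvd.2 hrm)

theorem pow_sub_one_ne_zero_of_one_lt_natAbs {a : ℤ} (ha : 1 < a.natAbs) {n : ℕ} (hn : n ≠ 0) :
    a ^ n - 1 ≠ 0 := fun h => by
  have h1 : a.natAbs ^ n = 1 := by rw [← Int.natAbs_pow, sub_eq_zero.1 h, Int.natAbs_one]
  exact (Nat.one_lt_pow hn ha).ne' h1

theorem two_mul_kPart_eight {a : ℤ} (ha : 1 < a.natAbs) (hodd : Odd a) :
    2 * (kPart 8 a : ℤ) = a ^ 4 + 1 := by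
  obtain ⟨w, hw⟩ : ∃ w, a ^ 4 = 8 * w + 1 := by
    obtain ⟨s, rfl⟩ := hodd
    exact ⟨2 * s ^ 4 + 4 * s ^ 3 + 3 * s ^ 2 + s, by ring⟩
  have hw0 : 0 ≤ 4 * w + 1 := by
    have : 0 ≤ a ^ 4 := by positivity
    omega
  have hco : IsCoprime (4 * w + 1) (4 * (4 * w)) :=
    IsCoprime.mul_right ⟨1, -w, by ring⟩ ⟨1, -1, by ring⟩
  have := kPart_prime_pow_eq (p := 2) (k := 2) (a := a) (m := 4 * w + 1) (c := 4 * (4 * w))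
    (by norm_num) (pow_sub_one_ne_zero_of_one_lt_natAbs ha (by norm_num))
    (by linear_combination (a ^ 4 + 8 * w + 1) * hw) hw0 ⟨2 * w, by ring⟩ hco
    ⟨2, by linear_combination (-2) * hw⟩ (fun r hr hd => by
      have hb : a ^ 2 ^ 2 - 1 = 2 * (4 * w) := by linear_combination hw
      rw [hb]
      rcases hr.dvd_or_dvd hd with h4 | h4
      · exact (h4.mul_right w).mul_left 2
      · exact h4.mul_left 2)
  norm_num at this
  linear_combination 2 * this - hw

theorem kPart_five_of_gcd_eq_one {a : ℤ} (ha : 1 < a.natAbs) (hodd : Odd a)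
    (h5 : Int.gcd 5 (a - 1) = 1) : (kPart 5 a : ℤ) = a ^ 4 + a ^ 3 + a ^ 2 + a + 1 := by
  have : Fact (Nat.Prime 5) := ⟨by norm_num⟩
  have hco : IsCoprime (a ^ 4 + a ^ 3 + a ^ 2 + a + 1) (a - 1) := by
    obtain ⟨u, v, huv⟩ := Int.isCoprime_iff_gcd_eq_one.2 h5
    exact ⟨u, v - u * (a ^ 3 + 2 * a ^ 2 + 3 * a + 4), by linear_combination huv⟩
  have := kPart_prime_pow_eq (p := 5) (k := 0) (a := a) (m := a ^ 4 + a ^ 3 + a ^ 2 + a + 1)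
    (c := a - 1) (by norm_num) (pow_sub_one_ne_zero_of_one_lt_natAbs ha (by norm_num))
    (by ring) (by nlinarith [sq_nonneg (a * (a + 1)), sq_nonneg (a + 1), sq_nonneg (a ^ 2)])
    (by
      obtain ⟨s, rfl⟩ := hodd
      exact ⟨8 * s ^ 4 + 20 * s ^ 3 + 20 * s ^ 2 + 10 * s + 2, by ring⟩)
    hco (by simp) (fun r _ hd => by simpa using hd)
  simpa using this

theorem five_mul_kPart_five_of_gcd_ne_one {a : ℤ} (ha : 1 < a.natAbs) (hodd : Odd a)
    (h5 : Int.gcd 5 (a - 1) ≠ 1) :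
    5 * (kPart 5 a : ℤ) = a ^ 4 + a ^ 3 + a ^ 2 + a + 1 := by
  have : Fact (Nat.Prime 5) := ⟨by norm_num⟩
  obtain ⟨t, ht⟩ : (5 : ℤ) ∣ a - 1 := by
    by_contra hd
    exact h5 (Int.isCoprime_iff_gcd_eq_one.1
      ((Int.prime_iff_natAbs_prime.2 (by norm_num)).coprime_iff_not_dvd.2 hd))
  obtain rfl : a = 5 * t + 1 := by linear_combination ht
  have hev : Even t := by
    obtain ⟨s, hs⟩ := hodd
    exact ⟨s - 2 * t, by omega⟩
  set m : ℤ := 125 * t ^ 4 + 125 * t ^ 3 + 50 * t ^ 2 + 10 * t + 1 with hm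
  have hco : IsCoprime m (5 * (5 * t)) :=
    IsCoprime.mul_right
      ⟨1, -(t * (25 * t ^ 3 + 25 * t ^ 2 + 10 * t + 2)), by rw [hm]; ring⟩
      ⟨1, -(25 * t ^ 3 + 25 * t ^ 2 + 10 * t + 2), by rw [hm]; ring⟩
  have := kPart_prime_pow_eq (p := 5) (k := 0) (a := 5 * t + 1) (m := m) (c := 5 * (5 * t))
    (by norm_num) (pow_sub_one_ne_zero_of_one_lt_natAbs ha (by norm_num))
    (by rw [hm]; ring)
    (by nlinarith [sq_nonneg (t * (2 * t + 1)), sq_nonneg (5 * t + 1), sq_nonneg (t ^ 2)])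
    (by
      obtain ⟨s, rfl⟩ := hev
      exact ⟨1000 * s ^ 4 + 500 * s ^ 3 + 100 * s ^ 2 + 10 * s, by rw [hm]; ring⟩)
    hco ⟨5, by ring⟩ (fun r hr hd => by
      have hb : (5 * t + 1) ^ 5 ^ 0 - 1 = 5 * t := by ring
      rw [hb]
      rcases hr.dvd_or_dvd hd with h | h
      · exact h.mul_right t
      · exact h)
  norm_num at this
  rw [this, hm]
  ring

/-- `gcd(k_8(a)-1, k_5(a)-1)` divides `(a²+1)(a+1)` if `gcd(5, a-1) = 1`,
and divides `4(a-1)` otherwise. -/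
theorem gcd_k8_k5 (a : ℤ) (ha : 1 < a.natAbs) (hodd : Odd a) :
    (Int.gcd 5 (a - 1) = 1 →
      (Int.gcd ((kPart 8 a : ℤ) - 1) ((kPart 5 a : ℤ) - 1) : ℤ) ∣ (a ^ 2 + 1) * (a + 1)) ∧
    (Int.gcd 5 (a - 1) ≠ 1 →
      (Int.gcd ((kPart 8 a : ℤ) - 1) ((kPart 5 a : ℤ) - 1) : ℤ) ∣ 4 * (a - 1)) := by
  have h8 := two_mul_kPart_eight ha hodd
  obtain ⟨x, hx⟩ := Int.gcd_dvd_left ((kPart 8 a : ℤ) - 1) ((kPart 5 a : ℤ) - 1)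
  obtain ⟨y, hy⟩ := Int.gcd_dvd_right ((kPart 8 a : ℤ) - 1) ((kPart 5 a : ℤ) - 1)
  constructor <;> intro h5
  · have hk := kPart_five_of_gcd_eq_one ha hodd h5
    exact ⟨y - 2 * x, by linear_combination hy - 2 * hx - hk + h8⟩
  · have hk := five_mul_kPart_five_of_gcd_ne_one ha hodd h5
    exact ⟨2 * a * x - 5 * (a - 1) * y, by
      linear_combination 2 * a * hx - 5 * (a - 1) * hy - a * h8 + (a - 1) * hk⟩
end
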